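/- arXiv:math/0209279 — 2 statements merged into one kernel-verified Lean document; each statement's English description precedes it below -/
import Mathlib

section
/- In a power-associative CC-loop, every cube is a WIP element: for all c and x, c³·((x·c³)\1) = x\1, where c³ = c·(c·c). -/
/-- A loop: a type with multiplication, identity, and two-sided division. -/
class Loop (Q : Type*) extends Mul Q, One Q where
  ld : Q → Q → Q  -- left division: `ld x y = x \ y`
  rd : Q → Q → Q  -- right division: `rd x y = x / y`
  one_mul : ∀ x : Q, 1 * x = x
  mul_one : ∀ x : Q, x * 1 = x
  mul_ld : ∀ x y : Q, x * ld x y = y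
  ld_mul : ∀ x y : Q, ld x (x * y) = y
  rd_mul : ∀ x y : Q, rd x y * y = x
  mul_rd : ∀ x y : Q, rd (x * y) y = x

namespace Loop

variable {Q : Type*} [Loop Q]

/-- A conjugacy closed loop (CC-loop). -/
def IsCC (Q : Type*) [Loop Q] : Prop :=
  (∀ x y z : Q, x * (y * z) = rd (x * y) x * (x * z)) ∧
  (∀ x y z : Q, (z * y) * x = (z * x) * ld x (y * x))

/-- The nucleus `N(Q)`. -/
def nucleus (Q : Type*) [Loop Q] : Set Q :=
  {a | (∀ x y : Q, a * (x * y) = (a * x) * y) ∧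
       (∀ x y : Q, x * (a * y) = (x * a) * y) ∧
       (∀ x y : Q, x * (y * a) = (x * y) * a)}

/-- A subloop: contains 1 and is closed under `·`, `\`, `/`. -/
def IsSubloop (S : Set Q) : Prop :=
  (1 : Q) ∈ S ∧ (∀ a ∈ S, ∀ b ∈ S, a * b ∈ S) ∧
  (∀ a ∈ S, ∀ b ∈ S, ld a b ∈ S) ∧ (∀ a ∈ S, ∀ b ∈ S, rd a b ∈ S)

/-- The subloop generated by a set `S`. -/
def closure (S : Set Q) : Set Q := ⋂₀ {T : Set Q | IsSubloop T ∧ S ⊆ T}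

/-- An element is power-associative if the subloop it generates is associative. -/
def IsPA (a : Q) : Prop :=
  ∀ x ∈ closure {a}, ∀ y ∈ closure {a}, ∀ z ∈ closure {a}, x * (y * z) = (x * y) * z

/-- Powers: `pow a 0 = 1`, `pow a (n+1) = a * pow a n`. -/
def pow (a : Q) : ℕ → Q
  | 0 => 1
  | n + 1 => a * pow a n

/-- A WIP (weak inverse property) element. -/
def IsWIP (c : Q) : Prop := ∀ x : Q, c * ld (x * c) 1 = ld x 1

end Loop

open Loop

/-- Pure group theory part. -/
theorem grp_core {H : Type*} [Group H] (L T E J : H)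
    (hL : E * L = L * E) (hT : E * T = T * E) (hJ : E * J = J * E)
    (hLT : L * T = T * L * E) (hJJ : J * J = 1)
    (h : J * (T * (L * T)) * J = L⁻¹ * T) (Te Le : H)
    (hTe : Te = E ^ 3 * T ^ 3) (hLe : Le = L ^ 3 * (E ^ 3)⁻¹)
    (hfin : J * (Te * (Le * Te)) * J = Le⁻¹ * Te) : J * (Le * Te) * J = Le⁻¹ := by
  have cL : Commute E L := hL
  have cT : Commute E T := hT
  have cJ : Commute E J := hJ
  have hJi : J⁻¹ = J := inv_eq_of_mul_eq_one_left hJJ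
  have c1 : L * T * L⁻¹ = T * E := by
    rw [hLT, mul_assoc T L E, ← hL]; first | (group; done) | simp [pow_three, mul_assoc]
  have c3 : L * T ^ 3 * L⁻¹ = T ^ 3 * E ^ 3 := by
    rw [← conj_pow, c1, (cT.symm).mul_pow]
  -- `J (L T T) J = T L⁻¹`
  have c2 : T * L⁻¹ = L⁻¹ * T * E := by
    have : L⁻¹ * (L * T) * L⁻¹ = L⁻¹ * (T * L * E) * L⁻¹ := by rw [hLT]
    have h2 : T * L * E = T * E * L := by rw [mul_assoc, ← hL, mul_assoc]
    rw [h2] at this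
    calc T * L⁻¹ = L⁻¹ * (L * T) * L⁻¹ := by first | (group; done) | simp [pow_three, mul_assoc]
      _ = L⁻¹ * (T * E * L) * L⁻¹ := this
      _ = L⁻¹ * T * E := by first | (group; done) | simp [pow_three, mul_assoc]
  have h' : J * (L * T * T) * J = T * L⁻¹ := by
    rw [c2, ← h]
    have : L * T * T = T * (L * T) * E := by
      calc L * T * T = T * L * (E * T) := by rw [hLT]; group
        _ = _ := by rw [hT]; group
    rw [this]
    calc J * (T * (L * T) * E) * J = J * (T * (L * T)) * (E * J) := by first | (group; done) | simp [pow_three, mul_assoc]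
      _ = _ := by rw [hJ]; first | (group; done) | simp [pow_three, mul_assoc]
  have h'' : J * (T * L⁻¹) * J = L * T * T := by
    rw [← h']
    calc J * (J * (L * T * T) * J) * J = (J * J) * (L * T * T) * (J * J) := by first | (group; done) | simp [pow_three, mul_assoc]
      _ = _ := by rw [hJJ]; first | (group; done) | simp [pow_three, mul_assoc]
  -- conjugate of h
  have hB : J * T ^ 3 * J = T ^ 3 * E ^ 3 := by
    have e1 : J * (L⁻¹ * T) * J = T * (L * T) := by
      rw [← h]
      calc J * (J * (T * (L * T)) * J) * J = (J * J) * (T * (L * T)) * (J * J) := by first | (group; done) | simp [pow_three, mul_assoc]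
        _ = _ := by rw [hJJ]; first | (group; done) | simp [pow_three, mul_assoc]
    calc J * T ^ 3 * J = J * (T * L⁻¹) * (L * T * T) * J := by first | (group; done) | simp [pow_three, mul_assoc]
      _ = J * (T * L⁻¹) * (J * J) * (L * T * T) * J := by rw [hJJ, mul_one]
      _ = (J * (T * L⁻¹) * J) * (J * (L * T * T) * J) := by first | (group; done) | simp [pow_three, mul_assoc]
      _ = L * T * T * (T * L⁻¹) := by rw [h'', h']
      _ = L * T ^ 3 * L⁻¹ := by first | (group; done) | simp [pow_three, mul_assoc]
      _ = _ := c3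
  have cJ3 : E ^ 3 * J = J * E ^ 3 := (cJ.pow_left 3).eq
  have cT3 : E ^ 3 * T ^ 3 = T ^ 3 * E ^ 3 := (cT.pow_pow 3 3).eq
  have hE6 : E ^ 3 * E ^ 3 = 1 := by
    have : T ^ 3 = T ^ 3 * (E ^ 3 * E ^ 3) := by
      calc T ^ 3 = (J * J) * T ^ 3 * (J * J) := by rw [hJJ]; first | (group; done) | simp [pow_three, mul_assoc]
        _ = J * (J * T ^ 3 * J) * J := by first | (group; done) | simp [pow_three, mul_assoc]
        _ = J * T ^ 3 * (E ^ 3 * J) := by rw [hB]; first | (group; done) | simp [pow_three, mul_assoc]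
        _ = J * T ^ 3 * J * E ^ 3 := by rw [cJ3]; first | (group; done) | simp [pow_three, mul_assoc]
        _ = _ := by rw [hB]; first | (group; done) | simp [pow_three, mul_assoc]
    exact (mul_eq_left.mp this.symm)
  have hT3L3 : L ^ 3 * T ^ 3 * (L ^ 3)⁻¹ = T ^ 3 * (E ^ 3) := by
    have cE3L : E ^ 3 * L⁻¹ = L⁻¹ * E ^ 3 := ((cL.inv_right).pow_left 3).eq
    have s : ∀ X, L * (X * E ^ 3) * L⁻¹ = L * X * L⁻¹ * E ^ 3 := fun X => by
      calc L * (X * E ^ 3) * L⁻¹ = L * X * (E ^ 3 * L⁻¹) := by first | (group; done) | simp [pow_three, mul_assoc]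
        _ = _ := by rw [cE3L]; first | (group; done) | simp [pow_three, mul_assoc]
    calc L ^ 3 * T ^ 3 * (L ^ 3)⁻¹ = L * (L * (L * T ^ 3 * L⁻¹) * L⁻¹) * L⁻¹ := by first | (group; done) | simp [pow_three, mul_assoc]
      _ = T ^ 3 * E ^ 3 * (E ^ 3 * E ^ 3) := by
          rw [c3, s, c3, s, s, c3]; first | (group; done) | simp [pow_three, mul_assoc]
      _ = _ := by rw [hE6, mul_one]
  have hJTe : J * Te * J = T ^ 3 := by
    calc J * Te * J = (J * E ^ 3) * T ^ 3 * J := by rw [hTe]; first | (group; done) | simp [pow_three, mul_assoc]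
      _ = E ^ 3 * (J * T ^ 3 * J) := by rw [← cJ3]; first | (group; done) | simp [pow_three, mul_assoc]
      _ = T ^ 3 * (E ^ 3 * E ^ 3) := by rw [hB, ← mul_assoc, cT3]; first | (group; done) | simp [pow_three, mul_assoc]
      _ = _ := by rw [hE6, mul_one]
  have key : T ^ 3 * (J * (Le * Te) * J) = Le⁻¹ * Te := by
    rw [← hfin]
    calc T ^ 3 * (J * (Le * Te) * J) = J * Te * J * (J * (Le * Te) * J) := by rw [hJTe]
      _ = J * Te * (J * J) * (Le * Te) * J := by first | (group; done) | simp [pow_three, mul_assoc]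
      _ = _ := by rw [hJJ]; first | (group; done) | simp [pow_three, mul_assoc]
  have key2 : Le⁻¹ * Te = T ^ 3 * Le⁻¹ := by
    rw [inv_mul_eq_iff_eq_mul, hLe, hTe]
    have cE3L : E ^ 3 * (L ^ 3)⁻¹ = (L ^ 3)⁻¹ * E ^ 3 := ((cL.pow_pow 3 3).inv_right).eq
    have cE3T : (E ^ 3)⁻¹ * T ^ 3 = T ^ 3 * (E ^ 3)⁻¹ := ((cT.pow_pow 3 3).inv_left).eq
    calc E ^ 3 * T ^ 3 = L ^ 3 * T ^ 3 * (L ^ 3)⁻¹ := by rw [hT3L3, cT3]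
      _ = L ^ 3 * (T ^ 3 * (E ^ 3)⁻¹) * (E ^ 3 * (L ^ 3)⁻¹) := by first | (group; done) | simp [pow_three, mul_assoc]
      _ = _ := by rw [← cE3T]; first | (group; done) | simp [pow_three, mul_assoc]
  rw [key2] at key
  exact mul_left_cancel key

namespace Loop
variable {Q : Type*} [Loop Q]

def Lp (x : Q) : Equiv.Perm Q := ⟨fun y => x * y, fun y => ld x y, ld_mul x, mul_ld x⟩
def Rp (x : Q) : Equiv.Perm Q :=
  ⟨fun y => y * x, fun y => rd y x, fun y => mul_rd y x, fun y => rd_mul y x⟩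
def Tp (x : Q) : Equiv.Perm Q := (Lp x)⁻¹ * Rp x

theorem Lp_apply (x y : Q) : Lp x y = x * y := rfl
theorem Rp_apply (x y : Q) : Rp x y = y * x := rfl
theorem Lpi_apply (x y : Q) : (Lp x)⁻¹ y = ld x y := rfl
theorem Rpi_apply (x y : Q) : (Rp x)⁻¹ y = rd y x := rfl

def Atp (a b c : Equiv.Perm Q) : Prop := ∀ y z, a y * b z = c (y * z)

theorem Atp.mul {a b c a' b' c' : Equiv.Perm Q} (h : Atp a b c) (h' : Atp a' b' c') :
    Atp (a * a') (b * b') (c * c') := fun y z => by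
  simp only [Equiv.Perm.mul_apply]; rw [h, h']

theorem Atp.inv {a b c : Equiv.Perm Q} (h : Atp a b c) : Atp a⁻¹ b⁻¹ c⁻¹ := fun y z => by
  rw [Equiv.Perm.eq_inv_iff_eq, ← h]; simp

theorem lam (hcc : IsCC Q) (x : Q) : Atp (Tp x)⁻¹ (Lp x) (Lp x) := fun y z => by
  have : (Tp x)⁻¹ = (Rp x)⁻¹ * Lp x := by simp [Tp]
  rw [this]; exact (hcc.1 x y z).symm

theorem rho (hcc : IsCC Q) (x : Q) : Atp (Rp x) (Tp x) (Rp x) := fun y z =>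
  (hcc.2 x z y).symm

theorem atp_l {a b : Equiv.Perm Q} (h : Atp a b b) (h1 : b 1 = 1) : a = b := by
  ext y; have := h y 1; rwa [h1, mul_one, mul_one] at this

theorem atp_r {a b : Equiv.Perm Q} (h : Atp a b a) (h1 : a 1 = 1) : b = a := by
  ext y; have := h 1 y; rwa [h1, one_mul, one_mul] at this

theorem ell (hcc : IsCC Q) (x y : Q) :
    Tp (x * y) * (Tp x)⁻¹ * (Tp y)⁻¹ = (Lp (x * y))⁻¹ * Lp x * Lp y ∧
    Atp ((Lp (x * y))⁻¹ * Lp x * Lp y) ((Lp (x * y))⁻¹ * Lp x * Lp y)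
      ((Lp (x * y))⁻¹ * Lp x * Lp y) := by
  have h := ((lam hcc (x * y)).inv.mul (lam hcc x)).mul (lam hcc y)
  rw [inv_inv] at h
  have e := atp_l h (by
    simp only [Equiv.Perm.mul_apply, Lp_apply, Lpi_apply, mul_one]
    have := ld_mul (x * y) 1; rwa [mul_one] at this)
  exact ⟨e, by rwa [e] at h⟩

theorem arr (hcc : IsCC Q) (x y : Q) :
    (Tp (x * y))⁻¹ * Tp y * Tp x = (Rp (x * y))⁻¹ * Rp y * Rp x := by
  have h := ((rho hcc (x * y)).inv.mul (rho hcc y)).mul (rho hcc x)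
  exact atp_r h (by
    simp only [Equiv.Perm.mul_apply, Rp_apply, Rpi_apply, one_mul]
    have := mul_rd 1 (x * y); rwa [one_mul] at this)

theorem comm_of_fix {f : Equiv.Perm Q} (h : Atp f f f) {c : Q} (hc : f c = c) :
    f * Lp c = Lp c * f ∧ f * Rp c = Rp c * f := by
  constructor
  · ext y; simp only [Equiv.Perm.mul_apply, Lp_apply]; rw [← h, hc]
  · ext y; simp only [Equiv.Perm.mul_apply, Rp_apply]; rw [← h, hc]

theorem mem_closure (c : Q) : c ∈ closure ({c} : Set Q) := fun _ hT => hT.2 rfl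
theorem sub_closure (c : Q) : IsSubloop (closure ({c} : Set Q)) :=
  ⟨fun _ hT => hT.1.1, fun a ha b hb T hT => hT.1.2.1 a (ha T hT) b (hb T hT),
   fun a ha b hb T hT => hT.1.2.2.1 a (ha T hT) b (hb T hT),
   fun a ha b hb T hT => hT.1.2.2.2 a (ha T hT) b (hb T hT)⟩

theorem lcancel {a b c : Q} (h : a * b = a * c) : b = c := by
  rw [← ld_mul a b, h, ld_mul]

theorem inv_left' (hpa : ∀ a : Q, IsPA a) (x : Q) : ld x 1 * x = 1 := by
  have hs := sub_closure x
  have hx := mem_closure x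
  have hi := hs.2.2.1 x hx 1 hs.1
  apply lcancel (a := x)
  rw [hpa x x hx _ hi x hx, mul_ld, one_mul, mul_one]

theorem ld_ld (hpa : ∀ a : Q, IsPA a) (x : Q) : ld (ld x 1) 1 = x := by
  apply lcancel (a := ld x 1)
  rw [mul_ld, inv_left' hpa]

def Jp (hpa : ∀ a : Q, IsPA a) : Equiv.Perm Q :=
  ⟨fun x => ld x 1, fun x => ld x 1, ld_ld hpa, ld_ld hpa⟩

theorem atp_J (hpa : ∀ a : Q, IsPA a) {a b c : Equiv.Perm Q} (h : Atp a b c) (h1 : c 1 = 1) :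
    Jp hpa * a = b * Jp hpa := by
  ext y
  show ld (a y) 1 = b (ld y 1)
  apply lcancel (a := a y)
  rw [h, mul_ld, mul_ld, h1]

theorem JJ (hpa : ∀ a : Q, IsPA a) : Jp hpa * Jp hpa = 1 := by
  ext x; exact ld_ld hpa x

theorem Tp_one' (x : Q) : Tp x 1 = 1 := by
  show ld x (1 * x) = 1
  rw [one_mul]; have := ld_mul x 1; rwa [mul_one] at this

theorem Rp_eq (x : Q) : Rp x = Lp x * Tp x := by simp [Tp]

theorem hJ (hcc : IsCC Q) (hpa : ∀ a : Q, IsPA a) (x : Q) :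
    Jp hpa * (Tp x * (Lp x * Tp x)) * Jp hpa = (Lp x)⁻¹ * Tp x := by
  have h := (lam hcc x).inv.mul (rho hcc x)
  rw [inv_inv] at h
  have := atp_J hpa h (Tp_one' x)
  rw [← Rp_eq, this, mul_assoc, JJ, _root_.mul_one]

theorem Lp_one : Lp (1 : Q) = 1 := by ext y; exact one_mul y
theorem Rp_one : Rp (1 : Q) = 1 := by ext y; exact mul_one y
theorem Tp_one : Tp (1 : Q) = 1 := by simp [Tp, Lp_one, Rp_one]

end Loop

open Loop

/-- Second group theory part: extracts the structure of the multiplication maps of powers. -/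
theorem grp_two {H : Type*} [Group H] (L T Li Ti Ld Td Le Te E F G : H)
    (hEL : E * L = L * E) (hET : E * T = T * E)
    (hFL : F * L = L * F) (hFT : F * T = T * F)
    (hGL : G * L = L * G) (hGT : G * T = T * G)
    (e1 : E⁻¹ = L * Li) (e2 : E = Ti * T) (e3 : E = Li * Ti * (L * T))
    (f1 : F = Ld⁻¹ * L * L) (f2 : F = Td * T⁻¹ * T⁻¹)
    (f3 : Td⁻¹ * T * T = (Ld * Td)⁻¹ * (L * T) * (L * T))
    (g1 : G = Le⁻¹ * L * Ld) (g2 : G = Te * T⁻¹ * Td⁻¹)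
    (g3 : Te⁻¹ * Td * T = (Le * Te)⁻¹ * (Ld * Td) * (L * T)) :
    L * T = T * L * E ∧ Te = E ^ 3 * T ^ 3 ∧ Le = L ^ 3 * (E ^ 3)⁻¹ := by
  have hLi : Li = L⁻¹ * E⁻¹ := by rw [e1]; first | (group; done) | simp [pow_three, mul_assoc]
  have hTi : Ti = E * T⁻¹ := by rw [e2]; first | (group; done) | simp [pow_three, mul_assoc]
  have hLT : L * T = T * L * E := by
    have a : E = L⁻¹ * T⁻¹ * (L * T) := by
      calc E = Li * Ti * (L * T) := e3
        _ = _ := by rw [hLi, hTi]; first | (group; done) | simp [pow_three, mul_assoc]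
    rw [a]; first | (group; done) | simp [pow_three, mul_assoc]
  have hLd : Ld = L * L * F⁻¹ := by rw [f1]; first | (group; done) | simp [pow_three, mul_assoc]
  have hTd : Td = F * T * T := by rw [f2]; first | (group; done) | simp [pow_three, mul_assoc]
  have hFE : F = E := by
    rw [hLd, hTd] at f3
    have a : (L * L * F⁻¹ * (F * T * T)) * ((F * T * T)⁻¹ * T * T) = L * T * (L * T) := by
      rw [f3]; first | (group; done) | simp [pow_three, mul_assoc]
    have b : L * L * F⁻¹ * T * T = L * T * L * T := by
      calc _ = (L * L * F⁻¹ * (F * T * T)) * ((F * T * T)⁻¹ * T * T) := by first | (group; done) | simp [pow_three, mul_assoc]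
        _ = _ := by rw [a]; first | (group; done) | simp [pow_three, mul_assoc]
    have b2 : L * F⁻¹ * T = T * L := by
      have b3 : L * (L * F⁻¹ * T) * T = L * (T * L) * T := by
        calc _ = L * L * F⁻¹ * T * T := by first | (group; done) | simp [pow_three, mul_assoc]
          _ = _ := by rw [b]; first | (group; done) | simp [pow_three, mul_assoc]
      exact mul_left_cancel (mul_right_cancel b3)
    have cF : F⁻¹ * T = T * F⁻¹ := (Commute.inv_left (show Commute F T from hFT)).eq
    rw [mul_assoc, cF, ← mul_assoc, hLT] at b2
    have : T * L * (E * F⁻¹) = T * L * 1 := by rw [← mul_assoc, b2, mul_one]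
    have := mul_left_cancel this
    exact (mul_inv_eq_one.mp this).symm
  subst hFE
  have cFL : Commute F L := hFL
  have cFT : Commute F T := hFT
  have hLe : Le = L * L * L * F⁻¹ * G⁻¹ := by rw [g1, hLd]; first | (group; done) | simp [pow_three, mul_assoc]
  have hTe : Te = G * F * T * T * T := by rw [g2, hTd]; first | (group; done) | simp [pow_three, mul_assoc]
  have hGE : G = F * F := by
    have a : (Le * Te) * (Te⁻¹ * Td * T) = Ld * Td * (L * T) := by rw [g3]; first | (group; done) | simp [pow_three, mul_assoc]
    have b : Le * Td * T = Ld * Td * L * T := by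
      calc _ = (Le * Te) * (Te⁻¹ * Td * T) := by first | (group; done) | simp [pow_three, mul_assoc]
        _ = _ := by rw [a]; first | (group; done) | simp [pow_three, mul_assoc]
    have b2 : Le * Td = Ld * Td * L := mul_right_cancel b
    have cG : Commute G F := by
      have hF : F = (T * L)⁻¹ * (L * T) := by rw [hLT]; first | (group; done) | simp [pow_three, mul_assoc]
      have x1 : Commute G L := hGL
      have x2 : Commute G T := hGT
      rw [hF]
      exact ((x2.mul_right x1).inv_right).mul_right (x1.mul_right x2)
    have d1 : L * T * T = T * T * L * F * F := by
      rw [hLT]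
      calc T * L * F * T = T * L * (F * T) := by first | (group; done) | simp [pow_three, mul_assoc]
        _ = T * (L * T) * F := by rw [hFT]; first | (group; done) | simp [pow_three, mul_assoc]
        _ = _ := by rw [hLT]; first | (group; done) | simp [pow_three, mul_assoc]
    have d2 : Le * Td = L * L * L * T * T * G⁻¹ := by
      have x1 : F⁻¹ * G⁻¹ = G⁻¹ * F⁻¹ := (cG.inv_inv.eq).symm
      have x2 : G⁻¹ * (T * T) = (T * T) * G⁻¹ :=
        (((show Commute G T from hGT).mul_right hGT).inv_left).eq
      calc Le * Td = L * L * L * (F⁻¹ * G⁻¹) * (F * T * T) := by rw [hLe, hTd]; first | (group; done) | simp [pow_three, mul_assoc]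
        _ = L * L * L * (G⁻¹ * (T * T)) := by rw [x1]; first | (group; done) | simp [pow_three, mul_assoc]
        _ = _ := by rw [x2]; first | (group; done) | simp [pow_three, mul_assoc]
    have d3 : Ld * Td * L = L * L * T * T * L := by rw [hLd, hTd]; first | (group; done) | simp [pow_three, mul_assoc]
    have d4 : L * L * (T * T * L) * (F * F * G⁻¹) = L * L * (T * T * L) * 1 := by
      calc _ = L * L * (T * T * L * F * F) * G⁻¹ := by first | (group; done) | simp [pow_three, mul_assoc]
        _ = L * L * L * T * T * G⁻¹ := by rw [← d1]; first | (group; done) | simp [pow_three, mul_assoc]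
        _ = L * L * T * T * L := by rw [← d2, b2, d3]
        _ = _ := by first | (group; done) | simp [pow_three, mul_assoc]
    exact (mul_inv_eq_one.mp (mul_left_cancel d4)).symm
  subst hGE
  refine ⟨hLT, ?_, ?_⟩
  · rw [hTe]; first | (group; done) | simp [pow_three, mul_assoc]
  · rw [hLe]; first | (group; done) | simp [pow_three, mul_assoc]

/-- In a power-associative CC-loop, every cube is a WIP element. -/
theorem stmt_17 {Q : Type*} [Loop Q] (hcc : IsCC Q) (hpa : ∀ a : Q, IsPA a) :
    ∀ c x : Q, (c * (c * c)) * ld (x * (c * (c * c))) 1 = ld x 1 := by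
  intro c x
  have hs := sub_closure c
  have hc := mem_closure c
  have hd := hs.2.1 c hc c hc
  have hi := hs.2.2.1 c hc 1 hs.1
  have a2 : c * (c * c) = (c * c) * c := hpa c c hc c hc c hc
  have a3 : c * ((c * c) * c) = (c * (c * c)) * c := hpa c c hc _ hd c hc
  obtain ⟨ee, ea⟩ := ell hcc c (ld c 1)
  obtain ⟨fe, fa⟩ := ell hcc c c
  obtain ⟨ge, ga⟩ := ell hcc c (c * c)
  have er := arr hcc c (ld c 1)
  have fr := arr hcc c c
  have gr := arr hcc c (c * c)
  rw [mul_ld, Lp_one, Tp_one] at ee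
  rw [mul_ld, Lp_one] at ea
  rw [mul_ld, Rp_one, Tp_one] at er
  simp only [inv_one, _root_.one_mul] at ee ea er
  have ec : (Lp c * Lp (ld c 1)) c = c := by
    show c * (ld c 1 * c) = c
    rw [inv_left' hpa, Loop.mul_one]
  have fc : ((Lp (c * c))⁻¹ * Lp c * Lp c) c = c := by
    show ld (c * c) (c * (c * c)) = c
    rw [a2, ld_mul]
  have gc : ((Lp (c * (c * c)))⁻¹ * Lp c * Lp (c * c)) c = c := by
    show ld (c * (c * c)) (c * ((c * c) * c)) = c
    rw [a3, ld_mul]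
  have cT : ∀ f : Equiv.Perm Q, f * Lp c = Lp c * f → f * Rp c = Rp c * f →
      f * Tp c = Tp c * f := fun f h1 h2 =>
    ((show Commute f (Lp c) from h1).inv_right.mul_right h2).eq
  obtain ⟨eL, eR⟩ := comm_of_fix ea ec
  obtain ⟨fL, fR⟩ := comm_of_fix fa fc
  obtain ⟨gL, gR⟩ := comm_of_fix ga gc
  have eT := cT _ eL eR
  have fT := cT _ fL fR
  have gT := cT _ gL gR
  have eJ := atp_J hpa ea (by
    show c * (ld c 1 * 1) = 1
    rw [Loop.mul_one, mul_ld])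
  have hEi : (Tp (ld c 1) * Tp c)⁻¹ = Lp c * Lp (ld c 1) := by rw [← ee]; first | (group; done) | simp [pow_three, mul_assoc]
  rw [← hEi] at eL eT eJ
  have EL := (Commute.inv_left_iff.mp (show Commute _ _ from eL)).eq
  have ET := (Commute.inv_left_iff.mp (show Commute _ _ from eT)).eq
  have EJ := (Commute.inv_left_iff.mp (show Commute _ _ from eJ.symm)).eq
  simp only [Rp_eq] at er fr gr
  obtain ⟨hLT, hTe, hLe⟩ := grp_two (Lp c) (Tp c) (Lp (ld c 1)) (Tp (ld c 1)) (Lp (c * c))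
    (Tp (c * c)) (Lp (c * (c * c))) (Tp (c * (c * c))) _ _ _ EL ET fL fT gL gT
    hEi rfl er rfl fe.symm fr rfl ge.symm gr
  have fin := grp_core (Lp c) (Tp c) _ (Jp hpa) EL ET EJ hLT (JJ hpa) (hJ hcc hpa c) _ _ hTe hLe
    (hJ hcc hpa (c * (c * c)))
  rw [← Rp_eq] at fin
  have fin2 : Lp (c * (c * c)) * (Jp hpa * Rp (c * (c * c))) = Jp hpa := by
    have : Jp hpa * Rp (c * (c * c)) * (Jp hpa * Jp hpa) =
      (Lp (c * (c * c)))⁻¹ * Jp hpa := by rw [← mul_assoc, fin]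
    rw [JJ, _root_.mul_one] at this
    rw [this]; first | (group; done) | simp [pow_three, mul_assoc]
  exact congrArg (fun f : Equiv.Perm Q => f x) fin2
end

section
/- If Q is a finite power-associative CC-loop whose order is relatively prime to 6, then Q is a group: x·(y·z) = (x·y)·z for all x, y, z ∈ Q. -/
open Loop
namespace CC19

variable {Q : Type*} [Loop Q]

lemma lcancel {x y z : Q} (h : x * y = x * z) : y = z := by
  rw [← Loop.ld_mul x y, h, Loop.ld_mul]

lemma rcancel {x y z : Q} (h : y * x = z * x) : y = z := by
  rw [← Loop.mul_rd y x, h, Loop.mul_rd]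

/-- Left translation. -/
def L (x : Q) : Equiv.Perm Q where
  toFun y := x * y
  invFun y := ld x y
  left_inv y := Loop.ld_mul x y
  right_inv y := Loop.mul_ld x y

/-- Right translation. -/
def R (x : Q) : Equiv.Perm Q where
  toFun y := y * x
  invFun y := rd y x
  left_inv y := Loop.mul_rd y x
  right_inv y := Loop.rd_mul y x

@[simp] lemma L_apply (x y : Q) : L x y = x * y := rfl
@[simp] lemma R_apply (x y : Q) : R x y = y * x := rfl
@[simp] lemma L_inv_apply (x y : Q) : (L x)⁻¹ y = ld x y := rfl
@[simp] lemma R_inv_apply (x y : Q) : (R x)⁻¹ y = rd y x := rfl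
@[simp] lemma L_symm_apply (x y : Q) : (Equiv.symm (L x)) y = ld x y := rfl
@[simp] lemma R_symm_apply (x y : Q) : (Equiv.symm (R x)) y = rd y x := rfl

/-- Middle translation. -/
def T (x : Q) : Equiv.Perm Q := (L x)⁻¹ * R x

lemma T_apply (x y : Q) : T x y = ld x (y * x) := rfl
lemma T_inv_apply (x y : Q) : (T x)⁻¹ y = rd (x * y) x := rfl
lemma mul_T (x y : Q) : x * T x y = y * x := by rw [T_apply, Loop.mul_ld]
lemma T_inv_mul (x y : Q) : (T x)⁻¹ y * x = x * y := by rw [T_inv_apply, Loop.rd_mul]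
lemma T_one (x : Q) : T x 1 = 1 := by
  apply lcancel (x := x); rw [mul_T, Loop.one_mul, Loop.mul_one]

/-- Autotopisms. -/
def Atp (α β γ : Equiv.Perm Q) : Prop := ∀ y z, γ (y * z) = α y * β z

lemma Atp.mul {α β γ α' β' γ' : Equiv.Perm Q} (h : Atp α β γ) (h' : Atp α' β' γ') :
    Atp (α * α') (β * β') (γ * γ') := fun y z => by
  simp only [Equiv.Perm.mul_apply]; rw [h', h]

lemma Atp.inv {α β γ : Equiv.Perm Q} (h : Atp α β γ) : Atp α⁻¹ β⁻¹ γ⁻¹ := fun y z => by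
  rw [Equiv.Perm.inv_eq_iff_eq, h]; simp

lemma Atp.aut1 {α γ : Equiv.Perm Q} (h : Atp α γ γ) (h1 : γ 1 = 1) : α = γ := by
  ext y
  have := h y 1
  rw [h1, Loop.mul_one, Loop.mul_one] at this
  exact this.symm

lemma Atp.aut2 {β γ : Equiv.Perm Q} (h : Atp γ β γ) (h1 : γ 1 = 1) : β = γ := by
  ext y
  have := h 1 y
  rw [h1, Loop.one_mul, Loop.one_mul] at this
  exact this.symm

lemma atpA (hcc : IsCC Q) (x : Q) : Atp (T x)⁻¹ (L x) (L x) := fun y z => hcc.1 x y z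
lemma atpB (hcc : IsCC Q) (x : Q) : Atp (R x) (T x) (R x) := fun y z => hcc.2 x z y

/-- Middle nuclear elements are nuclear. -/
lemma nuc_of_mid (hcc : IsCC Q) {b : Q} (h : ∀ x y : Q, x * (b * y) = (x * b) * y) :
    b ∈ nucleus Q := by
  have h1 : Atp (R b)⁻¹ (L b) 1 := fun y z => by
    have := h (rd y b) z
    rw [Loop.rd_mul] at this
    simpa using this.symm
  refine ⟨?_, h, ?_⟩
  · have h2 := (atpA hcc b).mul h1.inv
    intro y z
    have e1 := h2 y 1
    have e2 := h2 y z
    simp only [mul_inv_cancel, inv_one, _root_.mul_one, Equiv.Perm.one_apply, L_apply, Loop.mul_one]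
      at e1 e2
    rw [e2, ← e1]
  · have h2 := (atpB hcc b).mul h1
    intro y z
    have e1 := h2 1 z
    have e2 := h2 y z
    simp only [mul_inv_cancel, _root_.mul_one, Equiv.Perm.one_apply, R_apply, Loop.one_mul]
      at e1 e2
    rw [e2, ← e1]

lemma nuc_of_atp (hcc : IsCC Q) {α β : Equiv.Perm Q} (h : Atp α β 1) : β 1 ∈ nucleus Q := by
  have e1 : ∀ y, y = α y * β 1 := fun y => by simpa [Loop.mul_one] using h y 1
  have e2 : ∀ z, β z = β 1 * z := fun z => by
    have h1 := h (β 1) z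
    have h2 : α (β 1) = 1 := by
      apply rcancel (x := β 1); rw [← e1, Loop.one_mul]
    rw [h2, Loop.one_mul] at h1
    exact h1.symm
  apply nuc_of_mid hcc
  intro x y
  have h1 := h (x * β 1) y
  have h2 : α (x * β 1) = x := by
    apply rcancel (x := β 1); rw [← e1]
  rw [h2, e2 y] at h1
  exact h1.symm

lemma RL (hcc : IsCC Q) (x y : Q) : R x * L y = L (y * x) * T x := by
  ext z; exact hcc.2 x z y

lemma LR (hcc : IsCC Q) (x z : Q) : L x * R z = R (x * z) * (T x)⁻¹ := by
  ext y; exact hcc.1 x y z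

lemma L_eq (x : Q) : L x = R x * (T x)⁻¹ := by simp [T]

lemma RLR (hcc : IsCC Q) (x y : Q) : R x * L y * (R x)⁻¹ = L (y * x) * (L x)⁻¹ := by
  rw [RL hcc, T]; group

lemma LRL (hcc : IsCC Q) (x z : Q) : L x * R z * (L x)⁻¹ = R (x * z) * (R x)⁻¹ := by
  rw [LR hcc, T]; group

/-- Left multiplication group. -/
def LM (Q : Type*) [Loop Q] : Subgroup (Equiv.Perm Q) := Subgroup.closure (Set.range L)
/-- Right multiplication group. -/
def RM (Q : Type*) [Loop Q] : Subgroup (Equiv.Perm Q) := Subgroup.closure (Set.range R)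

lemma L_mem (x : Q) : L x ∈ LM Q := Subgroup.subset_closure ⟨x, rfl⟩
lemma R_mem (x : Q) : R x ∈ RM Q := Subgroup.subset_closure ⟨x, rfl⟩

lemma LM_atp (hcc : IsCC Q) {g : Equiv.Perm Q} (hg : g ∈ LM Q) :
    ∃ α : Equiv.Perm Q, α 1 = 1 ∧ Atp α g g := by
  induction hg using Subgroup.closure_induction with
  | mem x hx =>
    obtain ⟨x, rfl⟩ := hx
    exact ⟨_, by rw [Equiv.Perm.inv_eq_iff_eq, T_one], atpA hcc x⟩
  | one => exact ⟨1, rfl, fun _ _ => rfl⟩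
  | mul x y _ _ hx hy =>
    obtain ⟨a, ha, ha'⟩ := hx
    obtain ⟨b, hb, hb'⟩ := hy
    exact ⟨a * b, by simp [ha, hb], ha'.mul hb'⟩
  | inv x _ hx =>
    obtain ⟨a, ha, ha'⟩ := hx
    exact ⟨a⁻¹, by rw [Equiv.Perm.inv_eq_iff_eq, ha], ha'.inv⟩

lemma RM_atp (hcc : IsCC Q) {g : Equiv.Perm Q} (hg : g ∈ RM Q) :
    ∃ β : Equiv.Perm Q, β 1 = 1 ∧ Atp g β g := by
  induction hg using Subgroup.closure_induction with
  | mem x hx =>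
    obtain ⟨x, rfl⟩ := hx
    exact ⟨_, T_one x, atpB hcc x⟩
  | one => exact ⟨1, rfl, fun _ _ => rfl⟩
  | mul x y _ _ hx hy =>
    obtain ⟨a, ha, ha'⟩ := hx
    obtain ⟨b, hb, hb'⟩ := hy
    exact ⟨a * b, by simp [ha, hb], ha'.mul hb'⟩
  | inv x _ hx =>
    obtain ⟨a, ha, ha'⟩ := hx
    exact ⟨a⁻¹, by rw [Equiv.Perm.inv_eq_iff_eq, ha], ha'.inv⟩

lemma LM_aut (hcc : IsCC Q) {g : Equiv.Perm Q} (hg : g ∈ LM Q) (h1 : g 1 = 1) : Atp g g g := by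
  obtain ⟨α, -, h⟩ := LM_atp hcc hg
  have := h.aut1 h1
  rwa [this] at h

lemma RM_aut (hcc : IsCC Q) {g : Equiv.Perm Q} (hg : g ∈ RM Q) (h1 : g 1 = 1) : Atp g g g := by
  obtain ⟨α, -, h⟩ := RM_atp hcc hg
  have := h.aut2 h1
  rwa [this] at h

lemma nuc_of_LR (hcc : IsCC Q) {g : Equiv.Perm Q} (hg : g ∈ LM Q) (hg' : g ∈ RM Q) :
    g 1 ∈ nucleus Q := by
  obtain ⟨α, -, h⟩ := LM_atp hcc hg
  obtain ⟨β, h1, h'⟩ := RM_atp hcc hg'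
  have h2 := h.mul h'.inv
  rw [mul_inv_cancel] at h2
  have h3 := nuc_of_atp hcc h2
  have h4 : β⁻¹ 1 = 1 := by rw [Equiv.Perm.inv_eq_iff_eq, h1]
  rwa [Equiv.Perm.mul_apply, h4] at h3

lemma L_inv_R_L (hcc : IsCC Q) (w u : Q) : (L w)⁻¹ * R u * L w ∈ RM Q := by
  have R1 : R (1 : Q) = 1 := by ext y; exact Loop.mul_one y
  have e0 : (L w)⁻¹ * R w * L w = (R (ld w 1))⁻¹ := by
    have := LRL hcc w (ld w 1)
    rw [Loop.mul_ld, R1, _root_.one_mul] at this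
    have h2 : R w = (L w * R (ld w 1) * (L w)⁻¹)⁻¹ := by rw [this]; simp
    rw [h2]; group
  have e1 : (L w)⁻¹ * R u * L w = R (ld w u) * (R (ld w 1))⁻¹ := by
    have := LRL hcc w (ld w u)
    rw [Loop.mul_ld] at this
    have h2 : R u = (L w * R (ld w u) * (L w)⁻¹) * R w := by rw [this]; simp
    rw [h2, ← e0]; group
  rw [e1]
  exact mul_mem (R_mem _) (inv_mem (R_mem _))

lemma RM_conj (hcc : IsCC Q) (w : Q) {g : Equiv.Perm Q} (hg : g ∈ RM Q) :
    (L w)⁻¹ * g * L w ∈ RM Q := by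
  induction hg using Subgroup.closure_induction with
  | mem x hx => obtain ⟨x, rfl⟩ := hx; exact L_inv_R_L hcc w x
  | one => simp [one_mem]
  | mul x y _ _ hx hy =>
    have := mul_mem hx hy
    convert this using 1; group
  | inv x _ hx =>
    have := inv_mem hx
    convert this using 1; group

/-- left inner maps -/
def Li (x y : Q) : Equiv.Perm Q := (L (x * y))⁻¹ * L x * L y
/-- right inner maps -/
def Ri (x y : Q) : Equiv.Perm Q := (R (x * y))⁻¹ * R y * R x

lemma Li_LM (x y : Q) : Li x y ∈ LM Q :=
  mul_mem (mul_mem (inv_mem (L_mem _)) (L_mem _)) (L_mem _)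
lemma Ri_RM (x y : Q) : Ri x y ∈ RM Q :=
  mul_mem (mul_mem (inv_mem (R_mem _)) (R_mem _)) (R_mem _)

lemma Li_RM (hcc : IsCC Q) (y x : Q) : Li y x ∈ RM Q := by
  have h1 := RLR hcc x y
  have h2 := LRL hcc y x
  have h3 : Li y x = (L (y * x))⁻¹ * (R (y * x) * (R y)⁻¹ * (R x)⁻¹) * L (y * x) := by
    have : L (y * x) = R x * L y * (R x)⁻¹ * L x := by rw [h1]; simp
    rw [← h2, Li]
    nth_rewrite 3 [this]
    group
  rw [h3]
  exact RM_conj hcc _ (mul_mem (mul_mem (R_mem _) (inv_mem (R_mem _))) (inv_mem (R_mem _)))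

lemma Li_one (x y : Q) : Li x y 1 = 1 := by
  simp [Li, Loop.mul_one]
  apply lcancel (x := x * y); rw [Loop.mul_ld, Loop.mul_one]

lemma Ri_one (x y : Q) : Ri x y 1 = 1 := by
  simp [Ri, Loop.one_mul]
  apply rcancel (x := x * y); rw [Loop.rd_mul, Loop.one_mul]

lemma Li_aut (hcc : IsCC Q) (x y : Q) : Atp (Li x y) (Li x y) (Li x y) :=
  LM_aut hcc (Li_LM x y) (Li_one x y)
lemma Ri_aut (hcc : IsCC Q) (x y : Q) : Atp (Ri x y) (Ri x y) (Ri x y) :=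
  RM_aut hcc (Ri_RM x y) (Ri_one x y)

/-- associator -/
def as (x y z : Q) : Q := ld ((x * y) * z) (x * (y * z))

lemma as_spec (x y z : Q) : x * (y * z) = ((x * y) * z) * as x y z := by
  rw [as, Loop.mul_ld]

lemma Li_mul (x y z : Q) : (x * y) * Li x y z = x * (y * z) := by
  simp [Li, Loop.mul_ld]

lemma Ri_mul (x y z : Q) : Ri y z x * (y * z) = (x * y) * z := by
  simp [Ri, Loop.rd_mul]

lemma ass_nuc' (hcc : IsCC Q) (x y z : Q) : ld z (Li x y z) ∈ nucleus Q := by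
  have h1 : (L z)⁻¹ * Li x y * L z ∈ LM Q :=
    mul_mem (mul_mem (inv_mem (L_mem _)) (Li_LM _ _)) (L_mem _)
  have h2 := nuc_of_LR hcc h1 (RM_conj hcc z (Li_RM hcc x y))
  simpa [Loop.mul_one] using h2

lemma as_eq (hcc : IsCC Q) (x y z : Q) : as x y z = ld z (Li x y z) := by
  have h := (ass_nuc' hcc x y z).2.2 (x * y) z
  rw [Loop.mul_ld, Li_mul] at h
  rw [as, h, Loop.ld_mul]

lemma as_nuc (hcc : IsCC Q) (x y z : Q) : as x y z ∈ nucleus Q := by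
  rw [as_eq hcc]; exact ass_nuc' hcc x y z

lemma Li_eq (hcc : IsCC Q) (x y z : Q) : Li x y z = z * as x y z := by
  rw [as_eq hcc, Loop.mul_ld]

lemma nuc_one : (1 : Q) ∈ nucleus Q := by
  refine ⟨?_, ?_, ?_⟩ <;> intros <;> simp [Loop.one_mul, Loop.mul_one]

lemma nuc_mul {a b : Q} (ha : a ∈ nucleus Q) (hb : b ∈ nucleus Q) : a * b ∈ nucleus Q := by
  obtain ⟨a1, a2, a3⟩ := ha
  obtain ⟨b1, b2, b3⟩ := hb
  refine ⟨fun x y => ?_, fun x y => ?_, fun x y => ?_⟩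
  · rw [← a1, b1, a1, a1]
  · rw [← a1, a2, b2, a2]
  · rw [a2 y, b3, b3, a3, ← a2]

lemma inv_l {a : Q} (ha : a ∈ nucleus Q) : ld a 1 * a = 1 := by
  apply lcancel (x := a)
  rw [ha.1, Loop.mul_ld, Loop.one_mul, Loop.mul_one]

lemma nuc_inv (hcc : IsCC Q) {a : Q} (ha : a ∈ nucleus Q) : ld a 1 ∈ nucleus Q := by
  apply nuc_of_mid hcc
  intro x y
  have hx : x = rd x a * a := (Loop.rd_mul x a).symm
  rw [hx, ← ha.2.1, ha.1, Loop.mul_ld, Loop.one_mul, ← ha.2.1, Loop.mul_ld, Loop.mul_one]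

/-- The nucleus as a type -/
@[ext] structure Nuc (Q : Type*) [Loop Q] where
  val : Q
  property : val ∈ nucleus Q

lemma T_coset (hcc : IsCC Q) (x y : Q) :
    ∃ b ∈ nucleus Q, ∃ c ∈ nucleus Q, T x y = (b * y) * c := by
  have h1 := ((atpB hcc x).mul (atpA hcc y)).mul (atpB hcc x).inv
  have h2 := (atpA hcc (y * x)).mul (atpA hcc x).inv
  rw [RLR hcc] at h1
  have h3 := h1.mul h2.inv
  rw [mul_inv_cancel] at h3
  have h4 := nuc_of_atp hcc h3
  set β := T x * L y * (T x)⁻¹ * (L (y * x) * (L x)⁻¹)⁻¹ with hβ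
  have e2 : ∀ z, β z = β 1 * z := fun z => by
    have h5 := h3 (β 1) z
    have h6 := h3 (β 1) 1
    simp only [Equiv.Perm.one_apply, Loop.mul_one] at h5 h6
    have h7 := rcancel ((Loop.one_mul (β 1)).trans h6)
    rw [← h7, Loop.one_mul] at h5
    exact h5.symm
  have e3 : T x y = β 1 * ((y * x) * ld x 1) := by
    rw [← e2, hβ]
    have : (T x)⁻¹ 1 = 1 := by rw [Equiv.Perm.inv_eq_iff_eq, T_one]
    have h8 : ((L (y * x)) * (L x)⁻¹)⁻¹ (y * x * ld x 1) = 1 := by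
      rw [Equiv.Perm.inv_eq_iff_eq]; simp
    rw [Equiv.Perm.mul_apply, h8, Equiv.Perm.mul_apply, this]
    simp [Loop.mul_one]
  have e4 := as_spec y x (ld x 1)
  rw [Loop.mul_ld, Loop.mul_one] at e4
  have hn := as_nuc hcc y x (ld x 1)
  set n := as y x (ld x 1)
  have e5 : (y * x) * ld x 1 = y * ld n 1 := by
    apply rcancel (x := n)
    rw [← e4, ← hn.2.2, inv_l hn, Loop.mul_one]
  refine ⟨β 1, h4, ld n 1, nuc_inv hcc hn, ?_⟩
  rw [e3, e5, h4.1]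

lemma T_nuc (hcc : IsCC Q) (x : Q) {n : Q} (hn : n ∈ nucleus Q) : T x n ∈ nucleus Q := by
  obtain ⟨b, hb, c, hc, h⟩ := T_coset hcc x n
  rw [h]; exact nuc_mul (nuc_mul hb hn) hc

/-- commutators are nuclear -/
lemma T_comm (hcc : IsCC Q) (x y : Q) : ∃ n ∈ nucleus Q, T x y = y * n := by
  obtain ⟨b, hb, c, hc, h⟩ := T_coset hcc x y
  refine ⟨T y b * c, nuc_mul (T_nuc hcc y hb) hc, ?_⟩
  rw [h, ← mul_T y b, hc.2.2]

lemma mul_comm_nuc (hcc : IsCC Q) (x y : Q) : ∃ n ∈ nucleus Q, y * x = (x * y) * n := by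
  obtain ⟨n, hn, h⟩ := T_comm hcc x y
  exact ⟨n, hn, by rw [← hn.2.2, ← h, mul_T]⟩

instance : Mul (Nuc Q) := ⟨fun a b => ⟨a.1 * b.1, nuc_mul a.2 b.2⟩⟩
instance : One (Nuc Q) := ⟨⟨1, nuc_one⟩⟩

@[simp] lemma Nuc.mul_val (a b : Nuc Q) : (a * b).1 = a.1 * b.1 := rfl
@[simp] lemma Nuc.one_val : (1 : Nuc Q).1 = 1 := rfl

end CC19

namespace CC19

lemma key {P M : Type*} [Mul P] [AddCommGroup M] (ρ : P → M →+ M) (a : P → P → P → M)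
    (s12 : ∀ x y z, a x y z = a y x z) (s23 : ∀ x y z, a x y z = a x z y)
    (cross : ∀ x y z w, a x y (z * w) = ρ w (a x y z) + a x y w)
    (ρc : ∀ x y m, ρ x (ρ y m) = ρ y (ρ x m))
    (ρi : ∀ x m, ρ x m = 0 → m = 0)
    (ac : ∀ x y z w, a x y (z * w) = a x y (w * z))
    (h : ∀ x, a x x x = 0) (x y z : P) : (12 : ℤ) • a x y z = 0 := by
  have c2 : ∀ x y z w, a x (z * w) y = ρ w (a x z y) + a x w y := fun x y z w => by
    rw [s23 x (z * w), cross, s23 x y z, s23 x y w]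
  have c1 : ∀ x y z w, a (z * w) x y = ρ w (a z x y) + a w x y := fun x y z w => by
    rw [s12 (z * w), c2, s12 x z, s12 x w]
  have E1 : ∀ x y, (3 : ℤ) • (ρ y (a x x y) + a x y y) = 0 := fun x y => by
    apply ρi y
    have := h (x * y)
    simp only [c1, c2, cross, map_add, h, map_zero] at this
    have e1 : a x y x = a x x y := s23 _ _ _
    have e2 : a y x x = a x x y := by rw [s12, e1]
    have e3 : a y x y = a x y y := s12 _ _ _
    have e4 : a y y x = a x y y := by rw [s23, e3]
    rw [e1, e2, e3, e4] at this
    simp only [map_zsmul, map_add]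
    rw [← this]
    abel
  have F1 : ∀ x y, ρ x (a x x y) = a x x y := fun x y => by
    have := ac x x x y
    simp only [cross, h, map_zero, zero_add, add_zero] at this
    exact this.symm
  have sw : ∀ x y, a x y y = a y y x := fun x y => by rw [s12, s23]
  have F2 : ∀ x y, ρ y (a x y y) = a x y y := fun x y => by rw [sw, F1]
  have E2 : ∀ x y, (3 : ℤ) • (ρ x (a x y y) + a x x y) = 0 := fun x y => by
    have := E1 y x
    rwa [← sw x y, sw y x] at this
  have G : ∀ x y, (3 : ℤ) • (ρ y (a x x y)) = (3 : ℤ) • a x x y := fun x y => by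
    have h1 := congrArg (ρ x) (E1 x y)
    have h2 := E2 x y
    simp only [map_zsmul, map_add, map_zero] at h1
    rw [ρc, F1] at h1
    have : (3 : ℤ) • (ρ y (a x x y)) - (3 : ℤ) • a x x y =
      (3 : ℤ) • (ρ y (a x x y) + ρ x (a x y y)) - (3 : ℤ) • (ρ x (a x y y) + a x x y) := by abel
    rw [h1, h2, sub_zero, sub_eq_zero] at this
    exact this
  have G2 : ∀ x y, (3 : ℤ) • (ρ x (a x y y)) = (3 : ℤ) • a x y y := fun x y => by
    rw [sw, G]
  have E3 : ∀ x y, (3 : ℤ) • a x x y + (3 : ℤ) • a x y y = 0 := fun x y => by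
    rw [← G, ← smul_add, E1]
  have S : ∀ x y, (6 : ℤ) • a x x y = 0 := fun x y => by
    have h1 := E3 (x * x) y
    simp only [c1, c2, map_add, F1, smul_add, G2] at h1
    have h2 := E3 x y
    have : (6 : ℤ) • a x x y = ((3 : ℤ) • a x x y + (3 : ℤ) • a x x y + ((3 : ℤ) • a x x y + (3 : ℤ) • a x x y) + ((3 : ℤ) • a x y y + (3 : ℤ) • a x y y)) - (2 : ℤ) • ((3 : ℤ) • a x x y + (3 : ℤ) • a x y y) := by abel
    rw [this, h1, h2]; simp
  apply ρi y
  have h1 := S (x * y) z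
  simp only [c1, c2, map_add, smul_add] at h1
  have h2 := congrArg (fun m => ρ y (ρ y m)) (S x z)
  simp only [map_zsmul, map_zero] at h2
  rw [h2, S y z, s12 y x, zero_add, add_zero] at h1
  rw [map_zsmul, ← h1]; abel

variable {Q : Type*} [Loop Q]

lemma nuc_inv' {a : Q} (ha : a ∈ nucleus Q) : ld a 1 ∈ nucleus Q := by
  have k1 : ∀ x, a * (ld a 1 * x) = x := fun x => by rw [ha.1, Loop.mul_ld, Loop.one_mul]
  have k2 : ∀ x, (x * ld a 1) * a = x := fun x => by rw [← ha.2.2, inv_l ha, Loop.mul_one]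
  refine ⟨fun x y => ?_, fun x y => ?_, fun x y => ?_⟩
  · apply lcancel (x := a); rw [k1, ha.1, k1]
  · have hx : x = rd x a * a := (Loop.rd_mul x a).symm
    rw [hx, ← ha.2.1, ha.1, Loop.mul_ld, Loop.one_mul, ← ha.2.1, Loop.mul_ld, Loop.mul_one]
  · apply rcancel (x := a); rw [k2, ← ha.2.2, k2]

instance : Inv (Nuc Q) := ⟨fun a => ⟨ld a.1 1, nuc_inv' a.2⟩⟩

instance : Group (Nuc Q) := Group.ofLeftAxioms
  (fun a b c => Nuc.ext (a.2.1 b.1 c.1).symm)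
  (fun a => Nuc.ext (Loop.one_mul a.1))
  (fun a => Nuc.ext (inv_l a.2))

lemma T_nuc_surj (hcc : IsCC Q) (x : Q) {m : Q} (hm : m ∈ nucleus Q) :
    ∃ n ∈ nucleus Q, T x n = m := by
  refine ⟨(T x)⁻¹ m, ?_, by simp⟩
  obtain ⟨b, hb, c, hc, h⟩ := T_coset hcc x ((T x)⁻¹ m)
  set y := (T x)⁻¹ m
  have h1 : T x y = m := by simp [y]
  rw [h1] at h
  have h2 : y = (ld b 1 * m) * ld c 1 := by
    rw [h, ← hb.1, (nuc_inv' hb).1, inv_l hb, Loop.one_mul, ← hc.2.1, Loop.mul_ld, Loop.mul_one]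
  rw [h2]
  exact nuc_mul (nuc_mul (nuc_inv' hb) hm) (nuc_inv' hc)

/-- conjugation on the nucleus -/
def conj (hcc : IsCC Q) (w : Q) : Nuc Q →* Nuc Q where
  toFun n := ⟨T w n.1, T_nuc hcc w n.2⟩
  map_one' := Nuc.ext (T_one w)
  map_mul' n m := by
    ext
    apply lcancel (x := w)
    have h1 := T_nuc hcc w m.2
    simp only [Nuc.mul_val]
    rw [mul_T, h1.2.2, mul_T, ← n.2.1, ← n.2.1, mul_T]

lemma conj_val (hcc : IsCC Q) (w : Q) (n : Nuc Q) : (conj hcc w n).1 = T w n.1 := rfl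

lemma mul_conj (hcc : IsCC Q) (w : Q) (n : Nuc Q) : w * (conj hcc w n).1 = n.1 * w := mul_T _ _

lemma conj_inj (hcc : IsCC Q) (w : Q) (n : Nuc Q) (h : conj hcc w n = 1) : n = 1 := by
  have h1 := congrArg Nuc.val h
  rw [conj_val, Nuc.one_val, ← T_one w] at h1
  exact Nuc.ext ((T w).injective h1)

lemma conj_surj (hcc : IsCC Q) (w : Q) (m : Nuc Q) : ∃ n, conj hcc w n = m := by
  obtain ⟨n, hn, h⟩ := T_nuc_surj hcc w m.2
  exact ⟨⟨n, hn⟩, Nuc.ext h⟩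

lemma conj_mul (hcc : IsCC Q) (x y : Q) (n : Nuc Q) :
    conj hcc (x * y) n = conj hcc y (conj hcc x n) := by
  ext
  apply lcancel (x := x * y)
  rw [mul_conj, ← (conj hcc y (conj hcc x n)).2.2.2, mul_conj, (conj hcc x n).2.2.1, mul_conj,
    n.2.1]

lemma conj_nuc (hcc : IsCC Q) (n m : Nuc Q) : conj hcc n.1 m = n⁻¹ * m * n := by
  have : n * conj hcc n.1 m = m * n := Nuc.ext (mul_conj hcc n.1 m)
  rw [mul_assoc, ← this]; simp

/-- associator in the nucleus -/
def aN (hcc : IsCC Q) (x y z : Q) : Nuc Q := ⟨as x y z, as_nuc hcc x y z⟩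

lemma aN_spec (hcc : IsCC Q) (x y z : Q) : x * (y * z) = ((x * y) * z) * (aN hcc x y z).1 :=
  as_spec x y z

lemma aN_mul (hcc : IsCC Q) (x y z w : Q) :
    aN hcc x y (z * w) = conj hcc w (aN hcc x y z) * aN hcc x y w := by
  ext
  apply lcancel (x := z * w)
  have h1 : (z * w) * (aN hcc x y (z * w)).1 = Li x y (z * w) := (Li_eq hcc _ _ _).symm
  have h2 : z * (aN hcc x y z).1 = Li x y z := (Li_eq hcc _ _ _).symm
  have h3 : w * (aN hcc x y w).1 = Li x y w := (Li_eq hcc _ _ _).symm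
  rw [h1, Li_aut hcc x y z w, ← h2, ← h3]
  rw [← (aN hcc x y z).2.2.1, (aN hcc x y z).2.1, ← mul_conj hcc, ← (conj hcc w (aN hcc x y z)).2.2.1,
    ← (conj hcc w (aN hcc x y z) * aN hcc x y w).2.2.2]
  rfl

lemma aN_nuc (hcc : IsCC Q) (x y : Q) (n : Nuc Q) : aN hcc x y n.1 = 1 := by
  ext
  apply lcancel (x := (x * y) * n.1)
  rw [← aN_spec, n.2.2.2, Nuc.one_val, Loop.mul_one]

lemma aN_central (hcc : IsCC Q) (x y z : Q) (m : Nuc Q) : m * aN hcc x y z = aN hcc x y z * m := by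
  obtain ⟨n, rfl⟩ := conj_surj hcc z m
  have h1 := aN_mul hcc x y n.1 z
  rw [aN_nuc, map_one, _root_.one_mul, ← mul_conj hcc, aN_mul, aN_nuc, conj_nuc] at h1
  rw [_root_.mul_one, mul_assoc, inv_mul_eq_iff_eq_mul] at h1
  exact h1.symm

lemma aN_mem (hcc : IsCC Q) (x y z : Q) : aN hcc x y z ∈ Subgroup.center (Nuc Q) :=
  Subgroup.mem_center_iff.2 (aN_central hcc x y z)

lemma aN_mul_nuc (hcc : IsCC Q) (x y z : Q) (n : Nuc Q) :
    aN hcc x y (z * n.1) = aN hcc x y z := by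
  rw [aN_mul, aN_nuc, conj_nuc, _root_.mul_one, mul_assoc, ← aN_central, inv_mul_cancel_left]

lemma aN_comm (hcc : IsCC Q) (x y z w : Q) : aN hcc x y (z * w) = aN hcc x y (w * z) := by
  obtain ⟨n, hn, h⟩ := mul_comm_nuc hcc w z
  rw [h]
  exact aN_mul_nuc hcc x y (w * z) ⟨n, hn⟩

lemma Li_nuc (hcc : IsCC Q) (y x z : Q) (n : Nuc Q) : Li (y * n.1) x z = Li y x z := by
  apply lcancel (x := (y * n.1) * x)
  have hc := mul_conj hcc x n
  set m := conj hcc x n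
  have h1 : Li y x m.1 = m.1 := by
    apply lcancel (x := y * x); rw [Li_mul, m.2.2.2]
  have h2 : (y * n.1) * x = (y * x) * m.1 := by
    rw [← n.2.2.1, ← hc, m.2.2.2]
  rw [Li_mul, ← n.2.2.1, n.2.1, ← hc, ← m.2.2.1, ← Li_mul, Li_aut hcc y x m.1 z, h1, h2,
    m.2.2.1]

lemma Li_symm (hcc : IsCC Q) (x y : Q) : Li x y = Li y x := by
  have hv : T x ((T x)⁻¹ y) = y := by simp
  have hv2 := T_inv_mul x y
  have hL : ∀ z, x * (y * z) = (T x)⁻¹ y * (x * z) := fun z => hcc.1 x y z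
  obtain ⟨n, hn, h⟩ := T_comm hcc x ((T x)⁻¹ y)
  set v := (T x)⁻¹ y
  have h1 : v = y * ld n 1 := by
    rw [← hv, h, ← hn.2.1, Loop.mul_ld, Loop.mul_one]
  have h2 : Li x y = Li v x := by
    ext z
    apply lcancel (x := x * y)
    rw [Li_mul, ← hv2, Li_mul, hL]
  rw [h2, h1]
  ext z
  exact Li_nuc hcc y x z ⟨_, nuc_inv' hn⟩

lemma aN_s12 (hcc : IsCC Q) (x y z : Q) : aN hcc x y z = aN hcc y x z := by
  ext
  apply lcancel (x := z)
  have h1 : z * (aN hcc x y z).1 = Li x y z := (Li_eq hcc _ _ _).symm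
  have h2 : z * (aN hcc y x z).1 = Li y x z := (Li_eq hcc _ _ _).symm
  rw [h1, h2, Li_symm hcc]

lemma Ri_symm (hcc : IsCC Q) (x y z : Q) : Ri y x z = Ri x y z := by
  obtain ⟨n, hn, h⟩ := T_comm hcc x y
  apply rcancel (x := y * x)
  rw [Ri_mul]
  have h1 : y * x = (x * y) * n := by rw [← mul_T, h, hn.2.2]
  have h2 : (z * y) * x = (z * x) * (y * n) := by rw [← h]; exact hcc.2 x y z
  rw [h2, h1, hn.2.2, hn.2.2, Ri_mul]

lemma aN_s23 (hcc : IsCC Q) (x y z : Q) : aN hcc x y z = aN hcc x z y := by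
  obtain ⟨n, hn, h⟩ := mul_comm_nuc hcc y z
  have h1 := aN_spec hcc x y z
  have h2 := aN_spec hcc x z y
  rw [← Ri_mul x y z] at h1
  rw [← Ri_mul x z y] at h2
  rw [Ri_symm hcc, h, hn.2.2, h1, hn.2.2, ← hn.2.2 _ (aN hcc x y z).1,
    ← hn.2.1 _ (aN hcc x z y).1] at h2
  have h3 := lcancel h2
  have h4 : aN hcc x y z * ⟨n, hn⟩ = ⟨n, hn⟩ * aN hcc x z y := Nuc.ext h3
  rw [← aN_central] at h4
  exact mul_left_cancel h4

lemma conj_center (hcc : IsCC Q) (w : Q) {m : Nuc Q} (hm : m ∈ Subgroup.center (Nuc Q)) :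
    conj hcc w m ∈ Subgroup.center (Nuc Q) := by
  rw [Subgroup.mem_center_iff] at *
  intro k
  obtain ⟨n, rfl⟩ := conj_surj hcc w k
  rw [← map_mul, hm, map_mul]

lemma conj_conj (hcc : IsCC Q) (x y : Q) {m : Nuc Q} (hm : m ∈ Subgroup.center (Nuc Q)) :
    conj hcc x (conj hcc y m) = conj hcc y (conj hcc x m) := by
  rw [← conj_mul, ← conj_mul]
  obtain ⟨n, hn, h⟩ := mul_comm_nuc hcc x y
  rw [h, conj_mul]
  have h1 := Subgroup.mem_center_iff.1 (conj_center hcc (x * y) hm) ⟨n, hn⟩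
  have h2 := conj_nuc hcc ⟨n, hn⟩ (conj hcc (x * y) m)
  rw [mul_assoc, ← h1, inv_mul_cancel_left] at h2
  exact h2

instance : CommGroup (Subgroup.center (Nuc Q)) :=
  { (inferInstance : Group (Subgroup.center (Nuc Q))) with
    mul_comm := fun a b => Subtype.ext (Subgroup.mem_center_iff.1 b.2 a.1) }

/-- action on the center of the nucleus -/
def act (hcc : IsCC Q) (w : Q) :
    Additive (Subgroup.center (Nuc Q)) →+ Additive (Subgroup.center (Nuc Q)) :=
  MonoidHom.toAdditive (((conj hcc w).comp (Subgroup.center (Nuc Q)).subtype).codRestrict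
    (Subgroup.center (Nuc Q)) (fun m => conj_center hcc w m.2))

/-- associator in the center of the nucleus -/
def aC (hcc : IsCC Q) (x y z : Q) : Additive (Subgroup.center (Nuc Q)) :=
  Additive.ofMul ⟨aN hcc x y z, aN_mem hcc x y z⟩

lemma aN_pow (hcc : IsCC Q) (h : ∀ x : Q, x * (x * x) = (x * x) * x) (x y z : Q) :
    aN hcc x y z ^ 12 = 1 := by
  have := key (act hcc) (aC hcc)
    (fun x y z => congrArg Additive.ofMul (Subtype.ext (aN_s12 hcc x y z)))
    (fun x y z => congrArg Additive.ofMul (Subtype.ext (aN_s23 hcc x y z)))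
    (fun x y z w => congrArg Additive.ofMul (Subtype.ext (aN_mul hcc x y z w)))
    (fun x y m => congrArg Additive.ofMul (Subtype.ext (conj_conj hcc x y m.toMul.2)))
    (fun x m hm => congrArg Additive.ofMul (Subtype.ext (conj_inj hcc x m.toMul.1
      (congrArg (fun k : Additive (Subgroup.center (Nuc Q)) => k.toMul.1) hm))))
    (fun x y z w => congrArg Additive.ofMul (Subtype.ext (aN_comm hcc x y z w)))
    (fun x => congrArg Additive.ofMul (Subtype.ext (by
      ext
      apply lcancel (x := (x * x) * x)
      rw [← aN_spec]
      exact (h x).trans (Loop.mul_one _).symm))) x y z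
  have h2 := congrArg (fun k : Additive (Subgroup.center (Nuc Q)) => k.toMul.1) this
  exact h2

instance : MulAction (Nuc Q) Q where
  smul n x := n.1 * x
  one_smul x := Loop.one_mul x
  mul_smul a b x := (a.2.1 b.1 x).symm

lemma card_nuc (Q : Type*) [Loop Q] : Nat.card (Nuc Q) ∣ Nat.card Q := by
  have e := MulAction.selfEquivOrbitsQuotientProd (G := Nuc Q) (X := Q) (fun b => by
    rw [eq_bot_iff]
    intro n hn
    have h1 : n.1 * b = b := hn
    rw [Subgroup.mem_bot]
    ext
    apply rcancel (x := b)
    rw [h1, Nuc.one_val, Loop.one_mul])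
  rw [Nat.card_congr e, Nat.card_prod]
  exact Dvd.intro_left _ rfl

end CC19


/-- A finite power-associative CC-loop of order relatively prime to 6
is a group. -/
theorem stmt_19 {Q : Type*} [Loop Q] [Finite Q] (hcc : IsCC Q)
    (hpa : ∀ a : Q, IsPA a) (hcop : Nat.Coprime (Nat.card Q) 6) :
    ∀ x y z : Q, x * (y * z) = (x * y) * z := by
  have h3 : ∀ x : Q, x * (x * x) = (x * x) * x := fun x => by
    have hx : x ∈ Loop.closure {x} := fun S hS => hS.2 rfl
    exact hpa x x hx x hx x hx
  intro x y z
  have h1 := CC19.aN_pow hcc h3 x y z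
  have h2 : CC19.aN hcc x y z ^ Nat.card Q = 1 := by
    obtain ⟨k, hk⟩ := CC19.card_nuc Q
    rw [hk, pow_mul, pow_card_eq_one', one_pow]
  have h4 : Nat.Coprime (Nat.card Q) 12 := by
    have h6 : Nat.Coprime (Nat.card Q) 2 := hcop.coprime_dvd_right (by norm_num)
    exact (Nat.Coprime.mul_right hcop h6 : Nat.Coprime (Nat.card Q) (6 * 2))
  have h5 : orderOf (CC19.aN hcc x y z) = 1 := by
    have := Nat.dvd_gcd (orderOf_dvd_of_pow_eq_one h2) (orderOf_dvd_of_pow_eq_one h1)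
    rwa [h4, Nat.dvd_one] at this
  rw [orderOf_eq_one_iff] at h5
  rw [CC19.aN_spec hcc, h5, CC19.Nuc.one_val, Loop.mul_one]
end
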